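/- Let w : ℕ → Σ₃ be an infinite word that contains no factor of exponent 5/2 or greater and whose factor complexity equals 2n+1 for every n ≥ 0. If w contains none of the words 11, 12, 21, 22, 001, 00200 as a factor, then L(w) ⊇ L(g₁(G)), where g₁ is the morphism g₁ = [0020102, 00201, 002010201]. -/

import Mathlib

/-! Common definitions: the alphabet Σ₃, finite and infinite words, factors,
factor complexity, periods and exponents, morphisms, the morphism γ and its
fixed point G = γ^ω(0). -/

abbrev Sigma3 := Fin 3
abbrev Word := List Sigma3
abbrev InfWord := ℕ → Sigma3

/-- `u` is a factor of the infinite word `w`. -/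
def IsFactor (u : Word) (w : InfWord) : Prop :=
  ∃ i : ℕ, u = (List.range u.length).map (fun j => w (i + j))

/-- The set of finite factors of `w`. -/
def Lang (w : InfWord) : Set Word := {u | IsFactor u w}

/-- Factor complexity: the number of distinct length-`n` factors of `w`. -/
noncomputable def complexity (w : InfWord) (n : ℕ) : ℕ :=
  Set.ncard {u : Word | IsFactor u w ∧ u.length = n}

/-- `v` has period `p` (with `p ≥ 1`). -/
def HasPeriod (v : Word) (p : ℕ) : Prop :=
  1 ≤ p ∧ ∀ i, i + p < v.length → v.getD i 0 = v.getD (i + p) 0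

/-- The least period of `v`. -/
noncomputable def minPeriod (v : Word) : ℕ := sInf {p | HasPeriod v p}

/-- The exponent `|v| / p` of a nonempty finite word `v`, where `p` is its least period. -/
noncomputable def expo (v : Word) : ℝ := (v.length : ℝ) / (minPeriod v : ℝ)

/-- `w` contains no factor of exponent `5/2` or greater. -/
def NoFiveHalves (w : InfWord) : Prop :=
  ∀ u : Word, u ≠ [] → IsFactor u w → expo u < 5 / 2

/-- Apply a morphism (given by the images of the three letters) to a finite word. -/
def applyM (f : Sigma3 → Word) (u : Word) : Word := (u.map f).flatten

/-- The image under `f` of the length-`k` prefix of the infinite word `u`. -/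
def imPrefix (f : Sigma3 → Word) (u : InfWord) (k : ℕ) : Word :=
  applyM f ((List.range k).map u)

/-- The image of an infinite word under a (non-erasing) morphism. -/
def applyMInf (f : Sigma3 → Word) (u : InfWord) : InfWord :=
  fun n => (imPrefix f u (n + 1)).getD n 0

/-- The morphism `γ = [01, 2, 02]`. -/
def gam : Sigma3 → Word := ![[0, 1], [2], [0, 2]]

/-- The fixed point `G = γ^ω(0)` of `γ`, the unique infinite fixed point beginning with 0. -/
def G : InfWord := fun n => ((applyM gam)^[n + 1] [0]).getD n 0

/-- The final segment of `w` starting at position `k`. -/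
def shift (w : InfWord) (k : ℕ) : InfWord := fun i => w (i + k)

/-- The reverse `h^R` of a morphism `h`. -/
def mR (f : Sigma3 → Word) : Sigma3 → Word := fun x => (f x).reverse

/-- The morphism `g₁`. -/
def gOne : Sigma3 → Word :=
  ![[0, 0, 2, 0, 1, 0, 2], [0, 0, 2, 0, 1], [0, 0, 2, 0, 1, 0, 2, 0, 1]]

/-- The factor of `w` of length `n` starting at position `i`. -/
def factorAt (w : InfWord) (i n : ℕ) : Word := (List.range n).map fun j => w (i + j)

theorem length_factorAt (w : InfWord) (i n : ℕ) : (factorAt w i n).length = n := by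
  simp [factorAt]

theorem factorAt_add (w : InfWord) (i m n : ℕ) :
    factorAt w i (m + n) = factorAt w i m ++ factorAt w (i + m) n := by
  simp [factorAt, List.range_add, Function.comp_def, Nat.add_assoc]

theorem isFactor_factorAt (w : InfWord) (i n : ℕ) : IsFactor (factorAt w i n) w :=
  ⟨i, by rw [length_factorAt]; rfl⟩

theorem IsFactor.mono {u v : Word} {w : InfWord} (hv : IsFactor v w) (h : u <:+: v) :
    IsFactor u w := by
  obtain ⟨i, hi⟩ := hv
  obtain ⟨s, t, rfl⟩ := h
  change _ = factorAt w i _ at hi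
  rw [List.length_append, List.length_append, factorAt_add, factorAt_add] at hi
  have h1 := List.append_inj_left hi (by simp [length_factorAt])
  exact ⟨i + s.length, List.append_inj_right h1 (by simp [length_factorAt])⟩

/-- A word `Y t` in which `t` is a prefix of `Y t` has period `|Y|`, so its exponent is large
as soon as `|t| ≥ 3|Y|/2`. -/
theorem NoFiveHalves.not_isFactor {w : InfWord} (hp : NoFiveHalves w) (Y t : Word)
    (hY : Y ≠ []) (ht : t <+: Y ++ t) (hl : 3 * Y.length ≤ 2 * t.length) :
    ¬ IsFactor (Y ++ t) w := by
  intro hf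
  have hpos : 1 ≤ Y.length := List.length_pos_iff.2 hY
  have hper : HasPeriod (Y ++ t) Y.length := by
    refine ⟨hpos, fun i hi => ?_⟩
    have hi' : i < t.length := by simp at hi; omega
    rw [List.getD_append_right _ _ _ (i + Y.length) (by omega), Nat.add_sub_cancel]
    obtain ⟨s, hs⟩ := ht
    rw [← hs, List.getD_append _ _ _ _ hi']
  have hle : minPeriod (Y ++ t) ≤ Y.length := Nat.sInf_le hper
  have hmem : 1 ≤ minPeriod (Y ++ t) :=
    (Nat.sInf_mem (s := {p | HasPeriod (Y ++ t) p}) ⟨_, hper⟩).1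
  have hlt := hp (Y ++ t) (by simp [hY]) hf
  unfold expo at hlt
  rw [div_lt_iff₀ (by exact_mod_cast hmem)] at hlt
  have h1 : (minPeriod (Y ++ t) : ℝ) ≤ Y.length := by exact_mod_cast hle
  have h2 : (3 * Y.length : ℝ) ≤ 2 * t.length := by exact_mod_cast hl
  rw [List.length_append] at hlt
  push_cast at hlt
  linarith

/-- A square `XX` may not be extended periodically by half a period in total. -/
theorem NoFiveHalves.not_isFactor_square {w : InfWord} (hp : NoFiveHalves w) {P Q X : Word}
    (hX : X ≠ []) (hP : P <+: X) (hQ : Q <:+ X) (hl : X.length ≤ 2 * (P.length + Q.length)) :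
    ¬ IsFactor (Q ++ X ++ X ++ P) w := by
  obtain ⟨A, rfl⟩ := hQ
  have h := hp.not_isFactor (Q ++ A) (Q ++ (A ++ Q) ++ P) (by simpa [and_comm] using hX) ?_ ?_
  · simpa using h
  · obtain ⟨B, hB⟩ := hP
    refine ⟨B ++ P, ?_⟩
    simp only [List.append_assoc] at hB ⊢
    rw [← List.append_assoc P, hB]
    simp
  · simp at hl ⊢
    omega

theorem applyM_append (f : Sigma3 → Word) (u v : Word) :
    applyM f (u ++ v) = applyM f u ++ applyM f v := by
  simp [applyM]

/-- The morphism `g₁ ∘ γᵏ`. -/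
def level (k : ℕ) (v : Word) : Word := applyM gOne ((applyM gam)^[k] v)

theorem level_succ (k : ℕ) (v : Word) : level (k + 1) v = level k (applyM gam v) := rfl

theorem level_append (k : ℕ) (u v : Word) : level k (u ++ v) = level k u ++ level k v := by
  induction k generalizing u v with
  | zero => exact applyM_append _ _ _
  | succ k ih => rw [level_succ, applyM_append, ih]; rfl

theorem level_cons (k : ℕ) (a : Sigma3) (v : Word) :
    level k (a :: v) = level k [a] ++ level k v :=
  level_append k [a] v

theorem level_isInfix (k : ℕ) {u v : Word} (h : u <:+: v) : level k u <:+: level k v := by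
  obtain ⟨s, t, rfl⟩ := h
  exact ⟨level k s, level k t, by simp [level_append]⟩

theorem level_singleton_ne_nil (k : ℕ) (a : Sigma3) : level k [a] ≠ [] := by
  induction k generalizing a with
  | zero => fin_cases a <;> decide
  | succ k ih =>
    have : ∃ b v, applyM gam [a] = b :: v := by fin_cases a <;> simp [applyM, gam]
    obtain ⟨b, v, h⟩ := this
    rw [level_succ, h, level_cons]
    simp [ih]

theorem level_succ_zero (k : ℕ) : level (k + 1) [0] = level k [0] ++ level k [1] :=
  level_cons k 0 [1]

theorem level_succ_one (k : ℕ) : level (k + 1) [1] = level k [2] := rfl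

theorem level_succ_two (k : ℕ) : level (k + 1) [2] = level k [0] ++ level k [2] :=
  level_cons k 0 [2]

theorem length_level_one_le (k : ℕ) : (level k [1]).length ≤ (level k [2]).length := by
  cases k with
  | zero => decide
  | succ k => simp [level_succ_one, level_succ_two]

/-- The images of the letters under `g₁ ∘ γᵏ` have a long common prefix and a long common
suffix. -/
theorem exists_common_prefix_suffix (k : ℕ) : ∃ P Q : Word,
    (∀ a, P <+: level k [a]) ∧ (∀ a, Q <:+ level k [a]) ∧
      (level k [0]).length ≤ 2 * (P.length + Q.length) ∧
      (level k [2]).length ≤ 2 * (P.length + Q.length) := by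
  induction k using Nat.twoStepInduction with
  | zero => exact ⟨[0, 0, 2, 0, 1], [], by decide, by decide, by decide, by decide⟩
  | one =>
    exact ⟨[0, 0, 2, 0, 1, 0, 2, 0], [0, 2, 0, 1], by decide, by decide, by decide, by decide⟩
  | more k ih _ =>
    obtain ⟨P, Q, hP, hQ, h0, h2⟩ := ih
    have h12 := length_level_one_le k
    have e0 : level (k + 2) [0] = level k [0] ++ (level k [1] ++ level k [2]) := by
      simp [level_succ_zero, level_succ_one]
    have e1 : level (k + 2) [1] = level k [0] ++ level k [2] := by
      simp [level_succ_one, level_succ_two]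
    have e2 : level (k + 2) [2] = level k [0] ++ (level k [1] ++ (level k [0] ++ level k [2])) := by
      simp [level_succ_zero, level_succ_two]
    refine ⟨level k [0] ++ P, Q ++ level k [2], fun a => ?_, fun a => ?_, ?_, ?_⟩
    · fin_cases a
      · simpa [e0, List.prefix_append_right_inj] using (hP 1).trans (List.prefix_append _ _)
      · simpa [e1, List.prefix_append_right_inj] using hP 2
      · simpa [e2, List.prefix_append_right_inj] using (hP 1).trans (List.prefix_append _ _)
    · fin_cases a
      · obtain ⟨s, hs⟩ := hQ 1
        exact ⟨level k [0] ++ s, by simp [e0, ← hs]⟩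
      · obtain ⟨s, hs⟩ := hQ 0
        exact ⟨s, by simp [e1, ← hs]⟩
      · obtain ⟨s, hs⟩ := hQ 0
        exact ⟨level k [0] ++ (level k [1] ++ s), by simp [e2, ← hs]⟩
    · simp [e0]; omega
    · simp [e2]; omega

/-- In a preimage under `g₁ ∘ γᵏ` of a factor, neither `00` nor `22` occurs strictly inside. -/
theorem NoFiveHalves.not_isFactor_level {w : InfWord} (hp : NoFiveHalves w) (k : ℕ)
    {a : Sigma3} (ha : a ≠ 1) (x y : Sigma3) : ¬ IsFactor (level k [x, a, a, y]) w := by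
  intro h
  obtain ⟨P, Q, hP, hQ, h0, h2⟩ := exists_common_prefix_suffix k
  refine hp.not_isFactor_square (level_singleton_ne_nil k a) (hP a) (hQ a) ?_ (h.mono ?_)
  · fin_cases a
    · exact h0
    · exact absurd rfl ha
    · exact h2
  · obtain ⟨s, hs⟩ := hQ x
    obtain ⟨t, ht⟩ := hP y
    refine ⟨s, t, ?_⟩
    rw [level_cons k x, level_cons k a [a, y], level_cons k a [y], ← hs, ← ht]
    simp

theorem not_infix_of_not_infix_append {u v s t : Word} (h : ¬ u <:+: s ++ v ++ t) : ¬ u <:+: v :=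
  fun h' => h (h'.trans ⟨s, t, rfl⟩)

/-- Desubstitution: a word avoiding `00`, `11`, `21` and not starting with `1` is, up to its
last letter, an image under `γ`. -/
theorem exists_eq_applyM_gam (v : Word) (h00 : ¬ [0, 0] <:+: v) (h11 : ¬ [1, 1] <:+: v)
    (h21 : ¬ [2, 1] <:+: v) (hh : v.head? ≠ some 1) :
    ∃ v' t, v = applyM gam v' ++ t ∧ v.length ≤ 2 * v'.length + 1 := by
  match v with
  | [] => exact ⟨[], [], rfl, by simp⟩
  | [a] => exact ⟨[], [a], rfl, by simp⟩
  | 1 :: _ :: _ => simp at hh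
  | 2 :: b :: l =>
    have hb : b ≠ 1 := by
      rintro rfl
      exact h21 ⟨[], l, rfl⟩
    obtain ⟨v', t, hv, hl⟩ := exists_eq_applyM_gam (b :: l)
      (not_infix_of_not_infix_append (s := [2]) (t := []) (by simpa using h00))
      (not_infix_of_not_infix_append (s := [2]) (t := []) (by simpa using h11))
      (not_infix_of_not_infix_append (s := [2]) (t := []) (by simpa using h21)) (by simpa using hb)
    refine ⟨1 :: v', t, ?_, by simp at hl ⊢; omega⟩
    rw [hv]
    rfl
  | 0 :: b :: l =>
    have hb : b ≠ 0 := by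
      rintro rfl
      exact h00 ⟨[], l, rfl⟩
    have hl1 : l.head? ≠ some 1 := by
      intro h
      obtain ⟨l', rfl⟩ := List.head?_eq_some_iff.1 h
      fin_cases b
      · exact hb rfl
      · exact h11 ⟨[0], l', rfl⟩
      · exact h21 ⟨[0], l', rfl⟩
    obtain ⟨v', t, hv, hl⟩ := exists_eq_applyM_gam l
      (not_infix_of_not_infix_append (s := [0, b]) (t := []) (by simpa using h00))
      (not_infix_of_not_infix_append (s := [0, b]) (t := []) (by simpa using h11))
      (not_infix_of_not_infix_append (s := [0, b]) (t := []) (by simpa using h21)) hl1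
    fin_cases b
    · exact absurd rfl hb
    · exact ⟨0 :: v', t, by rw [hv]; rfl, by simp at hl ⊢; omega⟩
    · exact ⟨2 :: v', t, by rw [hv]; rfl, by simp at hl ⊢; omega⟩

/-- Any word of length at least two is its own interior with a letter on either side. -/
theorem exists_eq_cons_append_singleton {v : Word} (h : 2 ≤ v.length) :
    ∃ x m y, v = x :: (m ++ [y]) := by
  match v with
  | [] | [_] => simp at h
  | x :: b :: l =>
    exact ⟨x, (b :: l).dropLast, (b :: l).getLast (by simp), by simp [List.dropLast_concat_getLast]⟩

/-- An infix of the interior extends to the left and to the right. -/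
theorem exists_infix_extension {u m : Word} (x y : Sigma3) (h : u <:+: m) :
    ∃ a b, a :: (u ++ [b]) <:+: x :: (m ++ [y]) := by
  obtain ⟨s, t, rfl⟩ := h
  have hs : ∃ s' a, x :: s = s' ++ [a] :=
    ⟨(x :: s).dropLast, (x :: s).getLast (by simp), (List.dropLast_concat_getLast _).symm⟩
  have ht : ∃ b t', t ++ [y] = b :: t' := by
    cases t with
    | nil => exact ⟨y, [], rfl⟩
    | cons b t => exact ⟨b, t ++ [y], rfl⟩
  obtain ⟨s', a, hs⟩ := hs
  obtain ⟨b, t', ht⟩ := ht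
  refine ⟨a, b, s', t', ?_⟩
  have : x :: (s ++ u ++ t ++ [y]) = (x :: s) ++ u ++ (t ++ [y]) := by simp
  rw [this, hs, ht]
  simp

/-- `w` has arbitrarily long factors that are images under `g₁ ∘ γᵏ` of words without
`11` and `21`. -/
def HasPreimages (w : InfWord) (k : ℕ) : Prop :=
  ∀ N, ∃ v : Word, N ≤ v.length ∧ IsFactor (level k v) w ∧ ¬ [1, 1] <:+: v ∧ ¬ [2, 1] <:+: v

theorem NoFiveHalves.hasPreimages_succ {w : InfWord} (hp : NoFiveHalves w) {k : ℕ}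
    (h : HasPreimages w k) : HasPreimages w (k + 1) := by
  intro N
  obtain ⟨v, hN, hv, h11, h21⟩ := h (2 * N + 4)
  obtain ⟨x, m, y, rfl⟩ := exists_eq_cons_append_singleton (v := v) (by omega)
  have hsq : ∀ a : Sigma3, a ≠ 1 → ¬ [a, a] <:+: m := by
    intro a ha hm
    obtain ⟨b, c, hbc⟩ := exists_infix_extension x y hm
    exact hp.not_isFactor_level k ha b c (hv.mono (level_isInfix k hbc))
  have hm : m <:+: x :: (m ++ [y]) := ⟨[x], [y], by simp⟩
  have h11' : ¬ [1, 1] <:+: m := fun h => h11 (h.trans hm)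
  have h21' : ¬ [2, 1] <:+: m := fun h => h21 (h.trans hm)
  have hsplit : ∃ s r : Word, m = s ++ r ∧ s.length ≤ 1 ∧ r.head? ≠ some 1 := by
    by_cases hh : m.head? = some 1
    · obtain ⟨l, rfl⟩ := List.head?_eq_some_iff.1 hh
      refine ⟨[1], l, rfl, le_rfl, fun h => ?_⟩
      obtain ⟨l', rfl⟩ := List.head?_eq_some_iff.1 h
      exact h11' ⟨[], l', rfl⟩
    · exact ⟨[], m, rfl, by simp, hh⟩
  obtain ⟨s, r, rfl, hs, hr⟩ := hsplit
  have hrm : r <:+: s ++ r := (List.suffix_append s r).isInfix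
  obtain ⟨v', t, hv', hlen⟩ := exists_eq_applyM_gam r (fun h => hsq 0 (by decide) (h.trans hrm))
    (fun h => h11' (h.trans hrm)) (fun h => h21' (h.trans hrm)) hr
  have hgr : applyM gam v' <:+: r := ⟨[], t, by simp [hv']⟩
  have h22 : ∀ a : Sigma3, a ≠ 0 → ¬ [a, 1] <:+: v' := by
    rintro a ha ⟨p, q, hpq⟩
    refine hsq 2 (by decide) (List.IsInfix.trans ?_ (hgr.trans hrm))
    rw [← hpq, applyM_append, applyM_append]
    refine List.IsInfix.trans ?_ (List.infix_append _ _ _)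
    fin_cases a
    · exact absurd rfl ha
    · decide
    · decide
  refine ⟨v', ?_, ?_, h22 1 (by decide), h22 2 (by decide)⟩
  · simp at hN
    omega
  · rw [level_succ]
    exact hv.mono (level_isInfix k (hgr.trans (hrm.trans hm)))

theorem IsFactor.of_forall {w : InfWord} {u : Word} (i : ℕ)
    (h : ∀ j (hj : j < u.length), u[j] = w (i + j)) : IsFactor u w :=
  ⟨i, List.ext_getElem (by simp) fun j hj _ => by simpa using h j hj⟩

/-- A word with the local constraints of the theorem. -/
structure Constrained (w : InfWord) : Prop where
  noFiveHalves : NoFiveHalves w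
  zero_of_ne : ∀ i, w i ≠ 0 → w (i + 1) = 0
  two_of_zero_zero : ∀ i, w i = 0 → w (i + 1) = 0 → w (i + 2) = 2
  not_zero_zero_two_zero_zero : ¬ IsFactor [0, 0, 2, 0, 0] w

namespace Constrained

variable {w : InfWord}

theorem ne_of_alternating (hw : Constrained w) {i : ℕ} (h0 : w i = 0) (h1 : w (i + 1) ≠ 0)
    (h3 : w (i + 3) ≠ 0) : w (i + 3) ≠ w (i + 1) := by
  intro h
  have h2 := hw.zero_of_ne _ h1
  have h4 := hw.zero_of_ne _ h3
  refine hw.noFiveHalves.not_isFactor [0, w (i + 1)] [0, w (i + 1), 0] (by simp)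
    ⟨[w (i + 1), 0], rfl⟩ (by simp) (.of_forall i fun j hj => ?_)
  simp at hj
  interval_cases j <;> simp_all

/-- The words `0a0b0a0b0a` have exponent `5/2`. -/
theorem false_of_alternating (hw : Constrained w) {i : ℕ} (h0 : w i = 0)
    (h1 : w (i + 1) ≠ 0) (h3 : w (i + 3) ≠ 0) (h5 : w (i + 5) ≠ 0) (h7 : w (i + 7) ≠ 0)
    (h9 : w (i + 9) ≠ 0) : False := by
  have h2 := hw.zero_of_ne _ h1
  have h4 := hw.zero_of_ne _ h3
  have h6 := hw.zero_of_ne _ h5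
  have h8 := hw.zero_of_ne _ h7
  have n1 := hw.ne_of_alternating h0 h1 h3
  have n2 := hw.ne_of_alternating h2 h3 h5
  have n3 := hw.ne_of_alternating h4 h5 h7
  have n4 := hw.ne_of_alternating h6 h7 h9
  have third : ∀ a b c : Sigma3, a ≠ 0 → b ≠ 0 → c ≠ 0 → b ≠ a → c ≠ b → c = a := by decide
  have e5 := third _ _ _ h1 h3 h5 n1 n2
  have e7 := third _ _ _ h3 h5 h7 n2 n3
  have e9 := (third _ _ _ h5 h7 h9 n3 n4).trans e5
  refine hw.noFiveHalves.not_isFactor [0, w (i + 1), 0, w (i + 3)]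
    [0, w (i + 1), 0, w (i + 3), 0, w (i + 1)] (by simp) ⟨[0, w (i + 3), 0, w (i + 1)], rfl⟩
    (by simp) (.of_forall i fun j hj => ?_)
  simp at hj
  interval_cases j <;> simp_all

theorem exists_zero_zero (hw : Constrained w) : ∃ i, w i = 0 ∧ w (i + 1) = 0 := by
  by_contra! h
  have hz : ∃ i, w i = 0 := by
    by_cases h0 : w 0 = 0
    · exact ⟨0, h0⟩
    · exact ⟨1, hw.zero_of_ne 0 h0⟩
  obtain ⟨i, h0⟩ := hz
  have h1 := h _ h0
  have h3 := h _ (hw.zero_of_ne _ h1)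
  have h5 := h _ (hw.zero_of_ne _ h3)
  have h7 := h _ (hw.zero_of_ne _ h5)
  exact hw.false_of_alternating h0 h1 h3 h5 h7 (h _ (hw.zero_of_ne _ h7))

/-- Between two occurrences of `00` there is exactly one of the blocks of `g₁`. -/
theorem exists_block (hw : Constrained w) {i : ℕ} (h0 : w i = 0) (h1 : w (i + 1) = 0) :
    ∃ a, gOne a = factorAt w i (gOne a).length ∧
      w (i + (gOne a).length) = 0 ∧ w (i + (gOne a).length + 1) = 0 := by
  have other : ∀ a b : Sigma3, a ≠ 0 → b ≠ 0 → a ≠ b → (a = 2 → b = 1) ∧ (a = 1 → b = 2) := by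
    decide
  have h2 := hw.two_of_zero_zero i h0 h1
  have n2 : w (i + 2) ≠ 0 := by simp [h2]
  have h3 := hw.zero_of_ne _ n2
  have n4 : w (i + 4) ≠ 0 := by
    intro h4
    refine hw.not_zero_zero_two_zero_zero (.of_forall i fun j hj => ?_)
    simp at hj
    interval_cases j <;> simp_all
  have h4 := (other _ _ n2 n4 (hw.ne_of_alternating h1 n2 n4).symm).1 h2
  have h5 := hw.zero_of_ne _ n4
  by_cases n6 : w (i + 6) = 0
  · exact ⟨1, by simp [gOne, factorAt, List.range_succ, *], h5, n6⟩
  have h6 := (other _ _ n4 n6 (hw.ne_of_alternating h3 n4 n6).symm).2 h4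
  have h7 := hw.zero_of_ne _ n6
  by_cases n8 : w (i + 8) = 0
  · exact ⟨0, by simp [gOne, factorAt, List.range_succ, *], h7, n8⟩
  have h8 := (other _ _ n6 n8 (hw.ne_of_alternating h5 n6 n8).symm).1 h6
  have h9 := hw.zero_of_ne _ n8
  by_cases n10 : w (i + 10) = 0
  · exact ⟨2, by simp [gOne, factorAt, List.range_succ, *], h9, n10⟩
  exact (hw.false_of_alternating h1 n2 n4 n6 n8 n10).elim

theorem exists_applyM_gOne (hw : Constrained w) (N : ℕ) {i : ℕ} (h0 : w i = 0)
    (h1 : w (i + 1) = 0) :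
    ∃ v : Word, v.length = N ∧ applyM gOne v = factorAt w i (applyM gOne v).length := by
  induction N generalizing i with
  | zero => exact ⟨[], rfl, rfl⟩
  | succ N ih =>
    obtain ⟨a, ha, h0', h1'⟩ := hw.exists_block h0 h1
    obtain ⟨v, hv, hs⟩ := ih h0' h1'
    refine ⟨a :: v, by simp [hv], ?_⟩
    have : applyM gOne (a :: v) = gOne a ++ applyM gOne v := rfl
    rw [this, List.length_append, factorAt_add, ← ha, ← hs]

theorem hasPreimages_zero (hw : Constrained w) : HasPreimages w 0 := by
  intro N
  obtain ⟨i, h0, h1⟩ := hw.exists_zero_zero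
  obtain ⟨v, hv, hs⟩ := hw.exists_applyM_gOne (N + 2) h0 h1
  have hf : IsFactor (level 0 v) w := by
    change IsFactor (applyM gOne v) w
    rw [hs]
    exact isFactor_factorAt w i _
  obtain ⟨x, m, y, rfl⟩ := exists_eq_cons_append_singleton (v := v) (by omega)
  have hm : m <:+: x :: (m ++ [y]) := ⟨[x], [y], by simp⟩
  have key : ∀ a : Sigma3, a ≠ 0 → ¬ [a, 1] <:+: m := by
    intro a ha h
    obtain ⟨b, c, hbc⟩ := exists_infix_extension x y h
    have hinf : [0, 2, 0, 1, 0] ++ [0, 2, 0, 1, 0, 0, 2, 0] <:+: level 0 [a, 1, c] := by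
      clear hbc h
      revert a c
      decide
    refine hw.noFiveHalves.not_isFactor [0, 2, 0, 1, 0] [0, 2, 0, 1, 0, 0, 2, 0] (by simp)
      (by decide) (by simp) (hf.mono (hinf.trans (level_isInfix 0 (List.IsInfix.trans ?_ hbc))))
    exact (List.suffix_cons _ _).isInfix
  refine ⟨m, ?_, hf.mono (level_isInfix 0 hm), key 1 (by decide), key 2 (by decide)⟩
  simp at hv
  omega

theorem hasPreimages (hw : Constrained w) (k : ℕ) : HasPreimages w k := by
  induction k with
  | zero => exact hw.hasPreimages_zero
  | succ k ih => exact hw.noFiveHalves.hasPreimages_succ ih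

theorem isFactor_level_zero (hw : Constrained w) (k : ℕ) : IsFactor (level k [0]) w := by
  obtain ⟨v, hN, hv, -⟩ := hw.hasPreimages (k + 2) 1
  obtain ⟨a, l, rfl⟩ := List.exists_cons_of_length_pos hN
  have h : ∀ a, [0] <:+: applyM gam (applyM gam [a]) := by decide
  have ha : level (k + 2) [a] <:+: level (k + 2) (a :: l) := level_isInfix _ ⟨[], l, rfl⟩
  exact hv.mono ((level_isInfix k (h a)).trans ha)

end Constrained

theorem length_le_length_applyM {f : Sigma3 → Word} (hf : ∀ a, f a ≠ []) (u : Word) :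
    u.length ≤ (applyM f u).length := by
  induction u with
  | nil => simp
  | cons a u ih =>
    have := List.length_pos_iff.2 (hf a)
    change _ ≤ (f a ++ applyM f u).length
    simp
    omega

theorem applyM_isPrefix (f : Sigma3 → Word) {u v : Word} (h : u <+: v) :
    applyM f u <+: applyM f v := by
  obtain ⟨s, rfl⟩ := h
  exact ⟨applyM f s, (applyM_append f u s).symm⟩

theorem gam_ne_nil (a : Sigma3) : gam a ≠ [] := by
  fin_cases a <;> simp [gam]

theorem gOne_ne_nil (a : Sigma3) : gOne a ≠ [] := by
  fin_cases a <;> simp [gOne]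

theorem iterate_gam_isPrefix_succ (n : ℕ) :
    (applyM gam)^[n] [0] <+: (applyM gam)^[n + 1] [0] := by
  induction n with
  | zero => exact ⟨[1], rfl⟩
  | succ n ih =>
    rw [Function.iterate_succ_apply' _ n, Function.iterate_succ_apply' _ (n + 1)]
    exact applyM_isPrefix gam ih

theorem iterate_gam_isPrefix {m n : ℕ} (h : m ≤ n) :
    (applyM gam)^[m] [0] <+: (applyM gam)^[n] [0] := by
  induction n, h using Nat.le_induction with
  | base => exact List.prefix_rfl
  | succ n _ ih => exact ih.trans (iterate_gam_isPrefix_succ n)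

theorem lt_length_iterate_gam (n : ℕ) : n < ((applyM gam)^[n] [0]).length := by
  have head : ∀ n, ∃ l, (applyM gam)^[n] [0] = 0 :: l := fun n => by
    obtain ⟨l, hl⟩ := iterate_gam_isPrefix (Nat.zero_le n)
    exact ⟨l, hl.symm⟩
  induction n with
  | zero => simp
  | succ n ih =>
    obtain ⟨l, hl⟩ := head n
    rw [Function.iterate_succ_apply', hl]
    rw [hl] at ih
    have := length_le_length_applyM gam_ne_nil l
    change _ < ([0, 1] ++ applyM gam l).length
    simp at ih ⊢
    omega

theorem getD_eq_of_isPrefix {u v : Word} (h : u <+: v) {i : ℕ} (hi : i < u.length) :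
    u.getD i 0 = v.getD i 0 := by
  obtain ⟨s, rfl⟩ := h
  rw [List.getD_append _ _ _ _ hi]

theorem map_range_G_isPrefix {m n : ℕ} (h : m ≤ n) :
    (List.range m).map G <+: (applyM gam)^[n] [0] := by
  rw [List.prefix_iff_eq_take]
  have hn := lt_length_iterate_gam n
  refine List.ext_getElem (by simp; omega) fun i hi _ => ?_
  simp at hi
  have hi' := lt_length_iterate_gam (i + 1)
  have := getD_eq_of_isPrefix (iterate_gam_isPrefix (show i + 1 ≤ n by omega))
    (show i < _ by omega)
  rw [List.getElem_take, List.getElem_map, List.getElem_range, ← List.getD_eq_getElem _ 0, ← this]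
  rfl

theorem applyMInf_gOne_G {m n : ℕ} (h : m < n) :
    applyMInf gOne G m = (level n [0]).getD m 0 := by
  refine getD_eq_of_isPrefix (applyM_isPrefix gOne (map_range_G_isPrefix h)) ?_
  have := length_le_length_applyM gOne_ne_nil ((List.range (m + 1)).map G)
  simp at this
  omega

/-- Every factor of `g₁(G)` occurs in some `g₁(γⁿ(0))`. -/
theorem IsFactor.exists_infix_level {u : Word} (h : IsFactor u (applyMInf gOne G)) :
    ∃ n, u <:+: level n [0] := by
  obtain ⟨i, hi⟩ := h
  have hlen : i + u.length < (level (i + u.length) [0]).length :=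
    (lt_length_iterate_gam _).trans_le (length_le_length_applyM gOne_ne_nil _)
  refine ⟨i + u.length, ?_⟩
  have : u = ((level (i + u.length) [0]).drop i).take u.length := by
    refine List.ext_getElem (by simp; omega) fun j hj _ => ?_
    have hG := applyMInf_gOne_G (show i + j < i + u.length by omega)
    rw [List.getElem_of_eq hi, List.getElem_take, List.getElem_drop, List.getElem_map,
      List.getElem_range, hG, List.getD_eq_getElem]
  have hinf := (List.take_prefix u.length ((level (i + u.length) [0]).drop i)).isInfix.trans
    (List.drop_suffix i _).isInfix
  rwa [← this] at hinf

theorem constrained_of_not_isFactor {w : InfWord} (hp : NoFiveHalves w)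
    (h11 : ¬ IsFactor [1, 1] w) (h12 : ¬ IsFactor [1, 2] w) (h21 : ¬ IsFactor [2, 1] w)
    (h22 : ¬ IsFactor [2, 2] w) (h001 : ¬ IsFactor [0, 0, 1] w)
    (h00200 : ¬ IsFactor [0, 0, 2, 0, 0] w) : Constrained w := by
  have h000 : ¬ IsFactor [0, 0, 0] w :=
    hp.not_isFactor [0] [0, 0] (by simp) (by decide) (by simp)
  refine ⟨hp, fun i h => ?_, fun i h h' => ?_, h00200⟩
  · have hf : IsFactor [w i, w (i + 1)] w := ⟨i, rfl⟩
    generalize w i = a at h hf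
    generalize w (i + 1) = b at hf ⊢
    fin_cases a <;> fin_cases b <;> simp_all
  · have hf : IsFactor [w i, w (i + 1), w (i + 2)] w := ⟨i, rfl⟩
    rw [h, h'] at hf
    generalize w (i + 2) = b at hf ⊢
    fin_cases b <;> simp_all

/-- Case analysis step: an eligible word omitting the listed factors satisfies the
stated inclusion for the morphism `g₁`. -/
theorem stmt12 (w : InfWord) (hp : NoFiveHalves w)
    (hc : ∀ n : ℕ, complexity w n = 2 * n + 1)
    (h0 : ¬ IsFactor [1, 1] w)
    (h1 : ¬ IsFactor [1, 2] w)
    (h2 : ¬ IsFactor [2, 1] w)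
    (h3 : ¬ IsFactor [2, 2] w)
    (h4 : ¬ IsFactor [0, 0, 1] w)
    (h5 : ¬ IsFactor [0, 0, 2, 0, 0] w) :
    Lang (applyMInf ![[0, 0, 2, 0, 1, 0, 2], [0, 0, 2, 0, 1], [0, 0, 2, 0, 1, 0, 2, 0, 1]] G) ⊆ Lang w := by
  intro u hu
  obtain ⟨n, hn⟩ := IsFactor.exists_infix_level hu
  exact ((constrained_of_not_isFactor hp h0 h1 h2 h3 h4 h5).isFactor_level_zero n).mono hn
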